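/- Let H be an r-uniform hypergraph that is {0, ℓ}-intersecting for some 0 < ℓ < r. Let U(H) = {u ∈ V(H) : deg_H(u) ≥ r²} and let C(H) be the set of ℓ-element subsets that are cores of sunflowers with at least r² petals. Then U(H) equals the union of all members of C(H). In particular, if U(H) is nonempty, then ℓ divides |U(H)|. -/

import Mathlib

open Finset in
/-- Double counting incidences of pairs of members of two families. -/
lemma sum_deg_mul {α : Type*} [DecidableEq α] (V : Finset α) (G1 G2 : Finset (Finset α))
    (h1 : ∀ A ∈ G1, A ⊆ V) :
    ∑ y ∈ V, ((#{A ∈ G1 | y ∈ A} : ℤ) * (#{A ∈ G2 | y ∈ A} : ℤ))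
      = ∑ A ∈ G1, ∑ B ∈ G2, (#(A ∩ B) : ℤ) := by
  have e : ∀ (G : Finset (Finset α)) (y : α),
      (#{A ∈ G | y ∈ A} : ℤ) = ∑ A ∈ G, if y ∈ A then (1 : ℤ) else 0 := by
    intro G y; simp
  simp only [e, Finset.sum_mul_sum]
  rw [Finset.sum_comm]
  refine Finset.sum_congr rfl fun A hA => ?_
  rw [Finset.sum_comm]
  refine Finset.sum_congr rfl fun B _ => ?_
  have : A ∩ B = {y ∈ V | y ∈ A ∧ y ∈ B} := by
    ext y
    simp only [mem_inter, mem_filter]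
    exact ⟨fun h => ⟨h1 A hA h.1, h⟩, fun h => h.2⟩
  rw [this]
  simp only [← ite_and, mul_ite, mul_one, mul_zero]
  rw [Finset.card_filter]
  push_cast
  refine Finset.sum_congr rfl fun y _ => ?_
  by_cases ha : y ∈ A <;> by_cases hb : y ∈ B <;> simp [ha, hb]

open Finset in
lemma sum_row {α : Type*} [DecidableEq α] (s k : ℕ) (G : Finset (Finset α))
    (hunif : ∀ A ∈ G, #A = s)
    (hint : ∀ A ∈ G, ∀ B ∈ G, A ≠ B → #(A ∩ B) = k) (A : Finset α) (hA : A ∈ G) :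
    ∑ B ∈ G, (#(A ∩ B) : ℤ) = s + (#G - 1) * k := by
  rw [← Finset.add_sum_erase _ _ hA, Finset.inter_self, hunif A hA]
  have : ∑ B ∈ G.erase A, (#(A ∩ B) : ℤ) = ∑ B ∈ G.erase A, (k : ℤ) := by
    refine Finset.sum_congr rfl fun B hB => ?_
    rw [mem_erase] at hB
    rw [hint A hA B hB.2 (Ne.symm hB.1)]
  rw [this, Finset.sum_const, Finset.card_erase_of_mem hA]
  have : 1 ≤ #G := Finset.card_pos.2 ⟨A, hA⟩
  simp [Nat.cast_sub this]

open Finset in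
lemma deg_ineq {α : Type*} [DecidableEq α] (s k : ℕ) (V : Finset α) (F : Finset (Finset α))
    (hV : ∀ A ∈ F, A ⊆ V)
    (hunif : ∀ A ∈ F, #A = s)
    (hint : ∀ A ∈ F, ∀ B ∈ F, A ≠ B → #(A ∩ B) = k) (x : α) (hx : x ∈ V) :
    ((#{A ∈ F | x ∈ A} : ℤ) * #{A ∈ F | x ∉ A}) ^ 2 ≤
      (#{A ∈ F | x ∈ A} : ℤ) * #{A ∈ F | x ∉ A} * (s - k) *
        (#{A ∈ F | x ∈ A} + #{A ∈ F | x ∉ A}) := by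
  set G1 := {A ∈ F | x ∈ A} with hG1
  set G2 := {A ∈ F | x ∉ A} with hG2
  have s1 : G1 ⊆ F := filter_subset _ _
  have s2 : G2 ⊆ F := filter_subset _ _
  have own : ∀ G ⊆ F, ∑ y ∈ V, ((#{A ∈ G | y ∈ A} : ℤ) * (#{A ∈ G | y ∈ A} : ℤ))
      = #G * (s + (#G - 1) * k) := by
    intro G hG
    rw [sum_deg_mul V G G (fun A hA => hV A (hG hA))]
    rw [Finset.sum_congr rfl fun A hA => sum_row s k G (fun A hA => hunif A (hG hA))
      (fun A hA B hB => hint A (hG hA) B (hG hB)) A hA]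
    simp
  have cross : ∑ y ∈ V, ((#{A ∈ G1 | y ∈ A} : ℤ) * (#{A ∈ G2 | y ∈ A} : ℤ))
      = #G1 * (#G2 * k) := by
    rw [sum_deg_mul V G1 G2 (fun A hA => hV A (s1 hA))]
    have : ∀ A ∈ G1, ∑ B ∈ G2, (#(A ∩ B) : ℤ) = #G2 * k := by
      intro A hA
      have : ∀ B ∈ G2, (#(A ∩ B) : ℤ) = k := by
        intro B hB
        rw [hint A (s1 hA) B (s2 hB)]
        rintro rfl
        exact (mem_filter.1 hB).2 (mem_filter.1 hA).2
      rw [Finset.sum_congr rfl this]; simp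
    rw [Finset.sum_congr rfl this]; simp
  have o1 := own G1 s1
  have o2 := own G2 s2
  have key : ((#G2 : ℤ) * #{A ∈ G1 | x ∈ A} - #G1 * #{A ∈ G2 | x ∈ A}) ^ 2 ≤
      ∑ y ∈ V, ((#G2 : ℤ) * #{A ∈ G1 | y ∈ A} - #G1 * #{A ∈ G2 | y ∈ A}) ^ 2 :=
    Finset.single_le_sum
      (f := fun y => ((#G2 : ℤ) * #{A ∈ G1 | y ∈ A} - #G1 * #{A ∈ G2 | y ∈ A}) ^ 2)
      (fun y _ => sq_nonneg _) hx
  have e1 : {A ∈ G1 | x ∈ A} = G1 := by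
    rw [hG1, filter_filter]; simp
  have e2 : {A ∈ G2 | x ∈ A} = ∅ := by
    rw [hG2, filter_filter]; simp
  have expand : ∑ y ∈ V, ((#G2 : ℤ) * #{A ∈ G1 | y ∈ A} - #G1 * #{A ∈ G2 | y ∈ A}) ^ 2
      = (#G2 : ℤ) ^ 2 * ∑ y ∈ V, ((#{A ∈ G1 | y ∈ A} : ℤ) * (#{A ∈ G1 | y ∈ A} : ℤ))
        - 2 * #G1 * #G2 * ∑ y ∈ V, ((#{A ∈ G1 | y ∈ A} : ℤ) * (#{A ∈ G2 | y ∈ A} : ℤ))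
        + (#G1 : ℤ) ^ 2 * ∑ y ∈ V, ((#{A ∈ G2 | y ∈ A} : ℤ) * (#{A ∈ G2 | y ∈ A} : ℤ)) := by
    rw [Finset.mul_sum, Finset.mul_sum, Finset.mul_sum, ← Finset.sum_sub_distrib,
      ← Finset.sum_add_distrib]
    exact Finset.sum_congr rfl fun y _ => by ring
  rw [expand, o1, o2, cross, e1, e2] at key
  simp only [card_empty] at key
  push_cast at key
  linarith

open Finset in
/-- Deza's theorem (with the weaker bound `s²`, and `2 ≤ k`). -/
lemma deza {α : Type*} [DecidableEq α] (s k : ℕ) (hk : 2 ≤ k) (hks : k < s)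
    (F : Finset (Finset α)) (hF : s ^ 2 ≤ #F)
    (hunif : ∀ A ∈ F, #A = s)
    (hint : ∀ A ∈ F, ∀ B ∈ F, A ≠ B → #(A ∩ B) = k) :
    ∃ Y : Finset α, #Y = k ∧ ∀ A ∈ F, Y ⊆ A := by
  set V := F.biUnion id with hVdef
  have hV : ∀ A ∈ F, A ⊆ V := fun A hA => Finset.subset_biUnion_of_mem id hA
  have hsplit : ∀ x, #{A ∈ F | x ∈ A} + #{A ∈ F | x ∉ A} = #F := fun x =>
    Finset.card_filter_add_card_filter_not _
  have dich : ∀ x ∈ V, s ≤ #{A ∈ F | x ∈ A} → #{A ∈ F | x ∉ A} < s := by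
    intro x hx h1
    by_contra! h2
    have h := deg_ineq s k V F hV hunif hint x hx
    have hs := hsplit x
    generalize #{A ∈ F | x ∈ A} = d at *
    generalize #{A ∈ F | x ∉ A} = e at *
    zify at *
    rw [hs] at h
    have hd : (0 : ℤ) < d := by linarith
    have he : (0 : ℤ) < e := by linarith
    have h3 : (d : ℤ) * e ≤ (s - k) * #F := by
      have : 0 < (d : ℤ) * e := by positivity
      nlinarith
    nlinarith [mul_nonneg (sub_nonneg.2 h1) (sub_nonneg.2 h2)]
  set Y := {x ∈ V | s ≤ #{A ∈ F | x ∈ A}} with hY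
  have hsum : ∀ A ∈ F, ∑ y ∈ A, (#{B ∈ F | y ∈ B} : ℤ) = s + (#F - 1) * k := by
    intro A hA
    rw [← sum_row s k F hunif hint A hA]
    have := sum_deg_mul A {A} F (by simp)
    rw [Finset.sum_singleton] at this
    rw [← this]
    refine Finset.sum_congr rfl fun y hy => ?_
    rw [Finset.filter_singleton]; simp [hy]
  have hsp : ∀ A ∈ F, ∀ f : α → ℤ, ∑ y ∈ A, f y = ∑ y ∈ A ∩ Y, f y + ∑ y ∈ A \ Y, f y := by
    intro A _ f
    exact (Finset.sum_inter_add_sum_sdiff A Y f).symm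
  have hcardsp : ∀ A ∈ F, (#(A ∩ Y) : ℤ) + #(A \ Y) = s := by
    intro A hA
    have := Finset.card_inter_add_card_sdiff A Y
    rw [hunif A hA] at this
    exact_mod_cast this
  have hlo : ∀ A ∈ F, k ≤ #(A ∩ Y) := by
    intro A hA
    by_contra! hlt
    have h0 := hsum A hA
    rw [hsp A hA] at h0
    have a1 : ∑ y ∈ A ∩ Y, (#{B ∈ F | y ∈ B} : ℤ) ≤ #(A ∩ Y) * #F := by
      have := Finset.sum_le_card_nsmul (A ∩ Y) (fun y => (#{B ∈ F | y ∈ B} : ℤ)) (#F : ℤ)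
        (fun y _ => by exact_mod_cast Finset.card_filter_le _ _)
      simpa using this
    have a2 : ∑ y ∈ A \ Y, (#{B ∈ F | y ∈ B} : ℤ) ≤ #(A \ Y) * (s - 1) := by
      have := Finset.sum_le_card_nsmul (A \ Y) (fun y => (#{B ∈ F | y ∈ B} : ℤ)) (s - 1 : ℤ)
        (fun y hy => by
          rw [mem_sdiff, hY, mem_filter] at hy
          have : ¬ s ≤ #{B ∈ F | y ∈ B} := fun h => hy.2 ⟨hV A hA hy.1, h⟩
          have : #{B ∈ F | y ∈ B} + 1 ≤ s := by omega
          have : (#{B ∈ F | y ∈ B} : ℤ) + 1 ≤ s := by exact_mod_cast this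
          linarith)
      simpa using this
    have a3 := hcardsp A hA
    generalize #(A ∩ Y) = h at *
    generalize #(A \ Y) = g at *
    generalize #F = m at *
    have hg : (g : ℤ) = s - h := by linarith
    rw [hg] at a2
    zify at *
    have b1 : (s : ℤ) + (m - 1) * k ≤ h * m + (s - h) * (s - 1) := by linarith
    have b2 : (h : ℤ) + 1 ≤ k := hlt
    -- (m-1)(k-h) ≤ (s-h)(s-2)
    have b3 : ((m : ℤ) - 1) * (k - h) ≤ (s - h) * (s - 2) := by nlinarith
    have b4 : ((m : ℤ) - 1) ≤ (m - 1) * (k - h) := by nlinarith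
    have b5 : ((s : ℤ) - h) * (s - 2) ≤ s * (s - 2) := by nlinarith
    nlinarith
  have hhigh : ∀ y ∈ Y, #{A ∈ F | y ∉ A} + 1 ≤ s := by
    intro y hy
    rw [hY, mem_filter] at hy
    exact dich y hy.1 hy.2
  have hup : ∀ A ∈ F, #(A ∩ Y) ≤ k := by
    intro A hA
    by_contra! hlt
    have h0 := hsum A hA
    rw [hsp A hA] at h0
    have a1 : #(A ∩ Y) * ((#F : ℤ) - s + 1) ≤ ∑ y ∈ A ∩ Y, (#{B ∈ F | y ∈ B} : ℤ) := by
      have := Finset.card_nsmul_le_sum (A ∩ Y) (fun y => (#{B ∈ F | y ∈ B} : ℤ))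
        ((#F : ℤ) - s + 1)
        (fun y hy => by
          have h1 := hhigh y (mem_inter.1 hy).2
          have h2 := hsplit y
          zify at h1 h2
          linarith)
      simpa using this
    have a2 : (#(A \ Y) : ℤ) ≤ ∑ y ∈ A \ Y, (#{B ∈ F | y ∈ B} : ℤ) := by
      have := Finset.card_nsmul_le_sum (A \ Y) (fun y => (#{B ∈ F | y ∈ B} : ℤ)) 1
        (fun y hy => by
          have : 0 < #{B ∈ F | y ∈ B} :=
            Finset.card_pos.2 ⟨A, mem_filter.2 ⟨hA, (mem_sdiff.1 hy).1⟩⟩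
          exact_mod_cast this)
      simpa using this
    have a3 := hcardsp A hA
    generalize #(A ∩ Y) = h at *
    generalize #(A \ Y) = g at *
    generalize #F = m at *
    have hg : (g : ℤ) = s - h := by linarith
    rw [hg] at a2
    zify at *
    have b1 : (h : ℤ) * (m - s) ≤ (m - 1) * k := by linarith
    have b2 : (k : ℤ) + 1 ≤ h := hlt
    have b0 : (0 : ℤ) ≤ m - s := by nlinarith
    have b3 : ((k : ℤ) + 1) * (m - s) ≤ (m - 1) * k :=
      le_trans (mul_le_mul_of_nonneg_right b2 b0) b1
    have b4 : (m : ℤ) ≤ k * (s - 1) + s := by linarith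
    have b5 : (k : ℤ) * (s - 1) ≤ (s - 1) * (s - 1) :=
      mul_le_mul_of_nonneg_right (by linarith) (by linarith)
    nlinarith
  have hYk : #Y ≤ k := by
    by_contra! hlt
    obtain ⟨Z, hZY, hZ⟩ := Finset.exists_subset_card_eq (show k + 1 ≤ #Y from hlt)
    have hex : ∃ A ∈ F, Z ⊆ A := by
      by_contra! hno
      have hsub : F ⊆ Z.biUnion (fun y => {A ∈ F | y ∉ A}) := by
        intro A hA
        obtain ⟨y, hy, hyA⟩ := Finset.not_subset.1 (hno A hA)
        exact mem_biUnion.2 ⟨y, hy, mem_filter.2 ⟨hA, hyA⟩⟩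
      have h1 := (Finset.card_le_card hsub).trans
        (Finset.card_biUnion_le_card_mul Z _ (s - 1) (fun y hy => by
          have := hhigh y (hZY hy); omega))
      rw [hZ] at h1
      have h2 : (k + 1) * (s - 1) ≤ s * (s - 1) := Nat.mul_le_mul_right _ hks
      have h3 : s * (s - 1) < s * s := Nat.mul_lt_mul_of_pos_left (by omega) (by omega)
      nlinarith
    obtain ⟨A, hA, hZA⟩ := hex
    have h1 := Finset.card_le_card (Finset.subset_inter hZA hZY)
    have h2 := hup A hA
    omega
  have hYA : ∀ A ∈ F, Y ⊆ A := by
    intro A hA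
    have : A ∩ Y = Y := Finset.eq_of_subset_of_card_le Finset.inter_subset_right
      (hYk.trans (hlo A hA))
    exact Finset.inter_eq_right.1 this
  refine ⟨Y, le_antisymm hYk ?_, hYA⟩
  have hpos : 0 < #F := lt_of_lt_of_le (Nat.pow_pos (by omega)) hF
  obtain ⟨A, hA⟩ := Finset.card_pos.1 hpos
  exact (hlo A hA).trans (Finset.card_le_card Finset.inter_subset_right)


/-- In an `r`-uniform `{0,ℓ}`-intersecting hypergraph, the set `U` of
vertices of degree at least `r²` equals the union of all `ℓ`-element cores of
sunflowers with at least `r²` petals; in particular, if `U` is nonempty then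
`ℓ` divides `|U|`. -/
theorem stmt_3 {α : Type*} [DecidableEq α] (r ℓ : ℕ) (hℓ : 0 < ℓ) (hℓr : ℓ < r)
    (V : Finset α) (H : Finset (Finset α))
    (hedge : ∀ A ∈ H, A ⊆ V)
    (hunif : ∀ A ∈ H, A.card = r)
    (hint : ∀ A ∈ H, ∀ B ∈ H, A ≠ B → (A ∩ B).card = 0 ∨ (A ∩ B).card = ℓ)
    (U : Finset α)
    (hU : ∀ u, u ∈ U ↔ u ∈ V ∧ r ^ 2 ≤ (H.filter (fun A => u ∈ A)).card)
    (𝒞 : Finset (Finset α))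
    (h𝒞 : ∀ C, C ∈ 𝒞 ↔ C ⊆ V ∧ C.card = ℓ ∧
      ∃ P ⊆ H, r ^ 2 ≤ P.card ∧ ∀ A ∈ P, ∀ B ∈ P, A ≠ B → A ∩ B = C) :
    U = 𝒞.sup id ∧ (U.Nonempty → ℓ ∣ U.card) := by
  have hr2 : 2 ≤ r ^ 2 := by nlinarith
  -- the star of a vertex of large degree is a sunflower
  have star : ∀ u, r ^ 2 ≤ (H.filter (fun A => u ∈ A)).card →
      ∃ Y : Finset α, Y.card = ℓ ∧ u ∈ Y ∧ (∀ A ∈ H, u ∈ A → Y ⊆ A) ∧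
        ∀ A ∈ H, ∀ B ∈ H, u ∈ A → u ∈ B → A ≠ B → A ∩ B = Y := by
    intro u hu
    have hi : ∀ A ∈ H, ∀ B ∈ H, u ∈ A → u ∈ B → A ≠ B → (A ∩ B).card = ℓ := by
      intro A hA B hB ha hb hne
      rcases hint A hA B hB hne with h | h
      · rw [Finset.card_eq_zero] at h
        have : u ∈ A ∩ B := Finset.mem_inter.2 ⟨ha, hb⟩
        rw [h] at this
        simp at this
      · exact h
    have main : ∃ Y : Finset α, Y.card = ℓ ∧ ∀ A ∈ H, u ∈ A → Y ⊆ A := by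
      rcases Nat.lt_or_ge 1 ℓ with h2 | h1
      · obtain ⟨Y, hY, hYA⟩ := deza r ℓ h2 hℓr (H.filter (fun A => u ∈ A)) hu
          (fun A hA => hunif A (Finset.mem_filter.1 hA).1)
          (fun A hA B hB => hi A (Finset.mem_filter.1 hA).1 B (Finset.mem_filter.1 hB).1
            (Finset.mem_filter.1 hA).2 (Finset.mem_filter.1 hB).2)
        exact ⟨Y, hY, fun A hA ha => hYA A (Finset.mem_filter.2 ⟨hA, ha⟩)⟩
      · refine ⟨{u}, by rw [Finset.card_singleton]; omega, fun A _ ha => by simpa using ha⟩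
    obtain ⟨Y, hY, hYA⟩ := main
    have hcore : ∀ A ∈ H, ∀ B ∈ H, u ∈ A → u ∈ B → A ≠ B → A ∩ B = Y := by
      intro A hA B hB ha hb hne
      refine (Finset.eq_of_subset_of_card_le
        (Finset.subset_inter (hYA A hA ha) (hYA B hB hb)) ?_).symm
      rw [hi A hA B hB ha hb hne, hY]
    refine ⟨Y, hY, ?_, hYA, hcore⟩
    obtain ⟨A, hA, B, hB, hne⟩ := Finset.one_lt_card.1 (lt_of_lt_of_le (by omega) hu)
    rw [Finset.mem_filter] at hA hB
    rw [← hcore A hA.1 B hB.1 hA.2 hB.2 hne]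
    exact Finset.mem_inter.2 ⟨hA.2, hB.2⟩
  have petal : ∀ (C : Finset α) (P : Finset (Finset α)), r ^ 2 ≤ P.card →
      (∀ A ∈ P, ∀ B ∈ P, A ≠ B → A ∩ B = C) → ∀ A ∈ P, C ⊆ A := by
    intro C P hP hPC A hA
    obtain ⟨B, hB, hne⟩ := Finset.exists_mem_ne (lt_of_lt_of_le (by omega) hP) A
    rw [← hPC A hA B hB (Ne.symm hne)]
    exact Finset.inter_subset_left
  have degC : ∀ C ∈ 𝒞, ∀ u ∈ C, r ^ 2 ≤ (H.filter (fun A => u ∈ A)).card := by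
    intro C hC u hu
    obtain ⟨_, _, P, hPH, hP, hPC⟩ := (h𝒞 C).1 hC
    refine hP.trans (Finset.card_le_card fun A hA => ?_)
    exact Finset.mem_filter.2 ⟨hPH hA, petal C P hP hPC A hA hu⟩
  have hUeq : U = 𝒞.sup id := by
    ext u
    rw [Finset.mem_sup, hU]
    constructor
    · rintro ⟨_, hu⟩
      obtain ⟨Y, hY, huY, hYA, hcore⟩ := star u hu
      refine ⟨Y, (h𝒞 Y).2 ⟨?_, hY, H.filter (fun A => u ∈ A), Finset.filter_subset _ _, hu, ?_⟩,
        huY⟩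
      · obtain ⟨A, hA⟩ := Finset.card_pos.1 (lt_of_lt_of_le (by omega) hu)
        rw [Finset.mem_filter] at hA
        exact (hYA A hA.1 hA.2).trans (hedge A hA.1)
      · intro A hA B hB hne
        rw [Finset.mem_filter] at hA hB
        exact hcore A hA.1 B hB.1 hA.2 hB.2 hne
    · rintro ⟨C, hC, hu⟩
      exact ⟨((h𝒞 C).1 hC).1 hu, degC C hC u hu⟩
  refine ⟨hUeq, fun _ => ?_⟩
  have uniq : ∀ C ∈ 𝒞, ∀ u ∈ C, ∀ Y : Finset α,
      (∀ A ∈ H, ∀ B ∈ H, u ∈ A → u ∈ B → A ≠ B → A ∩ B = Y) → C = Y := by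
    intro C hC u hu Y hcore
    obtain ⟨_, _, P, hPH, hP, hPC⟩ := (h𝒞 C).1 hC
    have hp := petal C P hP hPC
    obtain ⟨A, hA, B, hB, hne⟩ := Finset.one_lt_card.1 (lt_of_lt_of_le (by omega) hP)
    rw [← hPC A hA B hB hne]
    exact hcore A (hPH hA) B (hPH hB) (hp A hA hu) (hp B hB hu) hne
  rw [hUeq, Finset.sup_eq_biUnion, Finset.card_biUnion]
  · exact Finset.dvd_sum fun C hC => by
      rw [id, ((h𝒞 C).1 hC).2.1]
  · intro C hC D hD hne
    refine Finset.disjoint_left.2 fun u hu hv => hne ?_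
    obtain ⟨Y, _, _, _, hcore⟩ := star u (degC C hC u hu)
    rw [uniq C hC u hu Y hcore, uniq D hD u hv Y hcore]
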